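/- Every rational lattice cone can be subdivided into smooth lattice cones. That is, for every lattice cone (C, Λ_C) there exists a finite set of lattice cones {(C_i, Λ_C)} with the C_i forming a subdivision of C (same dimension, union equal to C, pairwise intersecting along common faces) such that each (C_i, Λ_C) is smooth. -/

import Mathlib

/-- The closed convex polyhedral cone generated by vectors `v 0, …, v (n-1)`. -/
def polyCone {V : Type*} [AddCommGroup V] [Module ℝ V] {n : ℕ} (v : Fin n → V) : Set V :=
  {x | ∃ c : Fin n → ℝ, (∀ i, 0 ≤ c i) ∧ x = ∑ i, c i • v i}

/-- `F` is a face of the cone `C` (cut out by a supporting linear functional). -/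
def IsFace {V : Type*} [AddCommGroup V] [Module ℝ V] (C F : Set V) : Prop :=
  ∃ ℓ : V →ₗ[ℝ] ℝ, (∀ x ∈ C, ℓ x ≤ 0) ∧ F = {x ∈ C | ℓ x = 0}

/-- A rational vector of `ℝ^k`. -/
def IsRat {k : ℕ} (x : Fin k → ℝ) : Prop := ∀ i, ∃ q : ℚ, x i = (q : ℝ)

/-- `(C, Λ)` is a rational lattice cone: `C` is a polyhedral cone generated by rational
vectors and `Λ` is a finitely generated group of rational vectors spanning `lin(C)`. -/
def IsLatticeCone {k : ℕ} (C : Set (Fin k → ℝ)) (Λ : AddSubgroup (Fin k → ℝ)) : Prop :=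
  (∃ (n : ℕ) (v : Fin n → (Fin k → ℝ)), (∀ i, IsRat (v i)) ∧ C = polyCone v) ∧
  (∀ x ∈ Λ, IsRat x) ∧ Λ.FG ∧
  Submodule.span ℝ (Λ : Set (Fin k → ℝ)) = Submodule.span ℝ C

/-- A lattice cone `(C, Λ)` is smooth if the monoid `Λ ∩ C` has a monoid basis of
linearly independent lattice vectors. -/
def IsSmoothLatticeCone {k : ℕ} (C : Set (Fin k → ℝ)) (Λ : AddSubgroup (Fin k → ℝ)) : Prop :=
  ∃ (l : ℕ) (w : Fin l → (Fin k → ℝ)), LinearIndependent ℝ w ∧ (∀ i, w i ∈ Λ) ∧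
    (Λ : Set (Fin k → ℝ)) ∩ C = {x | ∃ c : Fin l → ℕ, x = ∑ i, (c i : ℝ) • w i}

open Module in
/-- Cells: a basis together with a linear functional. -/
abbrev RCell (d : ℕ) := Module.Basis (Fin d) ℝ (Fin d → ℝ) × ((Fin d → ℝ) →ₗ[ℝ] ℝ)

/-- Membership in the simplicial cone spanned by a basis. -/
def InCone {d : ℕ} (b : Module.Basis (Fin d) ℝ (Fin d → ℝ)) (x : Fin d → ℝ) : Prop :=
  ∀ i, 0 ≤ b.repr x i

/-- Regularity condition for a finite set of cells. -/
def GoodFan {d : ℕ} (F : Finset (RCell d)) : Prop :=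
  ∀ s ∈ F, ∀ t ∈ F, ∀ i, t.2 (s.1 i) ≤ s.2 (s.1 i) ∧
    (t.2 (s.1 i) = s.2 (s.1 i) → ∃ j, t.1 j = s.1 i)

/-- Integral vectors. -/
def IsIntVec {d : ℕ} (x : Fin d → ℝ) : Prop := ∀ i, ∃ z : ℤ, x i = (z : ℝ)

/-- Determinant of a basis. -/
noncomputable def bdet {d : ℕ} (b : Module.Basis (Fin d) ℝ (Fin d → ℝ)) : ℝ :=
  Matrix.det (fun j => b j : Matrix (Fin d) (Fin d) ℝ)

lemma bdet_ne_zero {d : ℕ} (b : Module.Basis (Fin d) ℝ (Fin d → ℝ)) : bdet b ≠ 0 := by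
  have h := b.linearIndependent
  have := (Matrix.linearIndependent_rows_iff_isUnit
    (A := (fun j => b j : Matrix (Fin d) (Fin d) ℝ))).1 h
  exact ((Matrix.isUnit_iff_isUnit_det _).1 this).ne_zero

lemma exists_basis_of_det {d : ℕ} (w : Fin d → (Fin d → ℝ))
    (h : Matrix.det (w : Matrix (Fin d) (Fin d) ℝ) ≠ 0) :
    ∃ b : Module.Basis (Fin d) ℝ (Fin d → ℝ), ∀ j, b j = w j := by
  have h1 : LinearIndependent ℝ w := (Matrix.linearIndependent_rows_iff_isUnit
    (A := (w : Matrix (Fin d) (Fin d) ℝ))).2 ((Matrix.isUnit_iff_isUnit_det _).2 h.isUnit)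
  have h2 := h1.span_eq_top_of_card_eq_finrank' (by simp)
  exact ⟨Module.Basis.mk h1 h2.ge, fun j => by simp⟩

lemma exists_exchange {d : ℕ} (b : Module.Basis (Fin d) ℝ (Fin d → ℝ)) (u : Fin d → ℝ)
    (i : Fin d) (h : b.repr u i ≠ 0) :
    ∃ b' : Module.Basis (Fin d) ℝ (Fin d → ℝ), (∀ j, b' j = Function.update (⇑b) i u j) ∧
      bdet b' = b.repr u i * bdet b := by
  have key : Matrix.det (Function.update (⇑b) i u : Matrix (Fin d) (Fin d) ℝ)
      = b.repr u i * bdet b := by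
    have := Matrix.det_updateRow_sum (fun j => b j : Matrix (Fin d) (Fin d) ℝ) i
      (fun k => b.repr u k)
    have h2 : ∑ k, b.repr u k • b k = u := b.sum_repr u
    rw [smul_eq_mul] at this
    rw [bdet, ← this]
    congr 1
    unfold Matrix.updateRow
    congr 1
    exact h2.symm
  obtain ⟨b', hb'⟩ := exists_basis_of_det (Function.update (⇑b) i u)
    (by rw [key]; exact mul_ne_zero h (bdet_ne_zero b))
  refine ⟨b', hb', ?_⟩
  rw [← key, bdet]
  congr 1
  funext j
  exact hb' j

lemma inCone_sum {d : ℕ} (b : Module.Basis (Fin d) ℝ (Fin d → ℝ)) {ι : Type*} (s : Finset ι)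
    (c : ι → ℝ) (x : ι → (Fin d → ℝ)) (hc : ∀ i ∈ s, 0 ≤ c i) (hx : ∀ i ∈ s, InCone b (x i)) :
    InCone b (∑ i ∈ s, c i • x i) := by
  intro i
  simp only [map_sum, map_smul, Finsupp.coe_finsetSum, Finset.sum_apply, Finsupp.coe_smul,
    Pi.smul_apply, smul_eq_mul]
  exact Finset.sum_nonneg fun k hk => mul_nonneg (hc k hk) (hx k hk i)

lemma inCone_basis {d : ℕ} (b : Module.Basis (Fin d) ℝ (Fin d → ℝ)) (j : Fin d) :
    InCone b (b j) := by
  intro i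
  rw [b.repr_self]
  by_cases h : j = i <;> simp [h, Finsupp.single_apply]

lemma inCone_iff {d : ℕ} (b : Module.Basis (Fin d) ℝ (Fin d → ℝ)) (x : Fin d → ℝ) :
    InCone b x ↔ ∃ c : Fin d → ℝ, (∀ i, 0 ≤ c i) ∧ x = ∑ i, c i • b i := by
  constructor
  · intro h
    exact ⟨fun i => b.repr x i, h, (b.sum_repr x).symm⟩
  · rintro ⟨c, hc, rfl⟩
    exact inCone_sum b _ _ _ (fun i _ => hc i) (fun i _ => inCone_basis b i)

lemma fun_eq_sum {d : ℕ} (b : Module.Basis (Fin d) ℝ (Fin d → ℝ))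
    (l : (Fin d → ℝ) →ₗ[ℝ] ℝ) (x : Fin d → ℝ) : l x = ∑ i, b.repr x i * l (b i) := by
  conv_lhs => rw [← b.sum_repr x]
  rw [map_sum]
  simp only [map_smul, smul_eq_mul]

lemma good_le {d : ℕ} {F : Finset (RCell d)} (hF : GoodFan F) {s t : RCell d} (hs : s ∈ F)
    (ht : t ∈ F) {x : Fin d → ℝ} (hx : InCone s.1 x) : t.2 x ≤ s.2 x := by
  rw [fun_eq_sum s.1 t.2, fun_eq_sum s.1 s.2]
  exact Finset.sum_le_sum fun i _ => mul_le_mul_of_nonneg_left (hF s hs t ht i).1 (hx i)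

lemma good_eq {d : ℕ} {F : Finset (RCell d)} (hF : GoodFan F) {s t : RCell d} (hs : s ∈ F)
    (ht : t ∈ F) {x : Fin d → ℝ} (hx : InCone s.1 x) (h : t.2 x = s.2 x) (k : Fin d)
    (hk : s.1.repr x k ≠ 0) : ∃ j, t.1 j = s.1 k := by
  rw [fun_eq_sum s.1 t.2, fun_eq_sum s.1 s.2] at h
  have := (Finset.sum_eq_sum_iff_of_le (fun i _ =>
    mul_le_mul_of_nonneg_left (hF s hs t ht i).1 (hx i))).1 h k (Finset.mem_univ _)
  exact (hF s hs t ht k).2 (mul_left_cancel₀ hk this)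

lemma good_inCone {d : ℕ} {F : Finset (RCell d)} (hF : GoodFan F) {s t : RCell d} (hs : s ∈ F)
    (ht : t ∈ F) {x : Fin d → ℝ} (hx : InCone s.1 x) (h : t.2 x = s.2 x) : InCone t.1 x := by
  rw [← s.1.sum_repr x]
  have : ∑ i, s.1.repr x i • s.1 i = ∑ i ∈ Finset.univ.filter (fun i => s.1.repr x i ≠ 0),
      s.1.repr x i • s.1 i := by
    rw [Finset.sum_filter]
    refine Finset.sum_congr rfl fun i _ => ?_
    by_cases h : s.1.repr x i = 0 <;> simp [h]
  rw [this]
  refine inCone_sum _ _ _ _ (fun i _ => hx i) fun i hi => ?_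
  obtain ⟨j, hj⟩ := good_eq hF hs ht hx h i (by simpa using hi)
  rw [← hj]
  exact inCone_basis _ _

lemma good_coef_lt {d : ℕ} {F : Finset (RCell d)} (hF : GoodFan F) {s t : RCell d} (hs : s ∈ F)
    (ht : t ∈ F) {x : Fin d → ℝ} (hx : InCone s.1 x) (hx' : InCone t.1 x)
    (h1 : ∀ i, s.1.repr x i < 1) (i : Fin d) : t.1.repr x i < 1 := by
  have heq : t.2 x = s.2 x := le_antisymm (good_le hF hs ht hx) (good_le hF ht hs hx')
  have h0 : t.1.repr x i = ∑ k, s.1.repr x k * t.1.repr (s.1 k) i := by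
    conv_lhs => rw [← s.1.sum_repr x]
    simp only [map_sum, map_smul, Finsupp.coe_finsetSum, Finset.sum_apply, Finsupp.coe_smul,
      Pi.smul_apply, smul_eq_mul]
  have h2 : t.1.repr x i = ∑ k, if t.1 i = s.1 k then s.1.repr x k else 0 := by
    rw [h0]
    refine Finset.sum_congr rfl fun k _ => ?_
    by_cases hk : s.1.repr x k = 0
    · simp [hk]
    · obtain ⟨j, hj⟩ := good_eq hF hs ht hx heq k hk
      rw [← hj, t.1.repr_self, Finsupp.single_apply]
      by_cases hij : j = i
      · simp [hij]
      · have : t.1 i ≠ t.1 j := fun h => hij (t.1.injective h).symm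
        simp [hij, this]
  rw [h2]
  by_cases hk : ∃ k, t.1 i = s.1 k
  · obtain ⟨k, hk⟩ := hk
    rw [hk]
    have : ∀ m, (s.1 k = s.1 m ↔ k = m) := fun m => s.1.injective.eq_iff
    simp [this, h1]
  · push Not at hk
    simp [hk]

/-- exchanged basis -/
noncomputable def exch {d : ℕ} (b : Module.Basis (Fin d) ℝ (Fin d → ℝ)) (u : Fin d → ℝ)
    (i : Fin d) : Module.Basis (Fin d) ℝ (Fin d → ℝ) :=
  open Classical in
  if h : b.repr u i ≠ 0 then (exists_exchange b u i h).choose else b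

lemma exch_apply {d : ℕ} (b : Module.Basis (Fin d) ℝ (Fin d → ℝ)) (u : Fin d → ℝ)
    (i : Fin d) (h : b.repr u i ≠ 0) (j : Fin d) :
    exch b u i j = if j = i then u else b j := by
  rw [exch, dif_pos h, (exists_exchange b u i h).choose_spec.1, Function.update_apply]

lemma exch_det {d : ℕ} (b : Module.Basis (Fin d) ℝ (Fin d → ℝ)) (u : Fin d → ℝ)
    (i : Fin d) (h : b.repr u i ≠ 0) :
    bdet (exch b u i) = b.repr u i * bdet b := by
  rw [exch, dif_pos h, (exists_exchange b u i h).choose_spec.2]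

open Classical in
/-- Stellar refinement of one cell at `u`. -/
noncomputable def refineCell {d : ℕ} (u : Fin d → ℝ) (ε : ℝ) (s : RCell d) : Finset (RCell d) :=
  if InCone s.1 u then
    (Finset.univ.filter (fun i => s.1.repr u i ≠ 0)).image
      (fun i => (exch s.1 u i, s.2 - (ε / s.1.repr u i) • s.1.coord i))
  else {s}

lemma mem_refine_of {d : ℕ} {u : Fin d → ℝ} {ε : ℝ} {s t : RCell d} (hs : InCone s.1 u) :
    t ∈ refineCell u ε s ↔ ∃ i, s.1.repr u i ≠ 0 ∧
      t = (exch s.1 u i, s.2 - (ε / s.1.repr u i) • s.1.coord i) := by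
  simp [refineCell, hs, eq_comm]

lemma mem_refine_of_not {d : ℕ} {u : Fin d → ℝ} {ε : ℝ} {s t : RCell d} (hs : ¬ InCone s.1 u) :
    t ∈ refineCell u ε s ↔ t = s := by
  simp [refineCell, hs]

/-- The refined cells cover exactly the original cell. -/
lemma refine_cover {d : ℕ} {u : Fin d → ℝ} (hu : u ≠ 0) (ε : ℝ) (s : RCell d) (x : Fin d → ℝ) :
    InCone s.1 x ↔ ∃ t ∈ refineCell u ε s, InCone t.1 x := by
  by_cases hs : InCone s.1 u
  swap
  · simp [mem_refine_of_not hs]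
  constructor
  · intro hx
    have hne : (Finset.univ.filter (fun i => s.1.repr u i ≠ 0)).Nonempty := by
      by_contra hcon
      rw [Finset.not_nonempty_iff_eq_empty, Finset.filter_eq_empty_iff] at hcon
      apply hu
      apply s.1.ext_elem
      intro i
      simpa using hcon (Finset.mem_univ i)
    obtain ⟨i, hi, hmin⟩ := Finset.exists_min_image _
      (fun i => s.1.repr x i / s.1.repr u i) hne
    replace hi : s.1.repr u i ≠ 0 := by simpa using hi
    refine ⟨_, (mem_refine_of hs).2 ⟨i, hi, rfl⟩, ?_⟩
    rw [inCone_iff]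
    set r := s.1.repr x i / s.1.repr u i with hr
    have hr0 : 0 ≤ r := div_nonneg (hx i) (hs i)
    refine ⟨fun j => if j = i then r else s.1.repr x j - r * s.1.repr u j, ?_, ?_⟩
    · intro j
      by_cases hj : j = i
      · simp [hj, hr0]
      · simp only [hj, if_false, sub_nonneg]
        by_cases hz : s.1.repr u j = 0
        · simp [hz, hx j]
        · have hm := hmin j (by simpa using hz)
          have : 0 < s.1.repr u j := lt_of_le_of_ne (hs j) (Ne.symm hz)
          exact (le_div_iff₀ this).1 hm
    · simp only [exch_apply _ _ _ hi]
      have h1 : ∀ j, (if j = i then r else s.1.repr x j - r * s.1.repr u j) •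
          (if j = i then u else s.1 j) =
          (s.1.repr x j - r * s.1.repr u j) • s.1 j + if j = i then r • u else 0 := by
        intro j
        by_cases hj : j = i
        · subst hj
          have : s.1.repr x j - r * s.1.repr u j = 0 := by
            rw [hr]; field_simp; ring
          simp [this]
        · simp [hj]
      simp only [h1, Finset.sum_add_distrib, sub_smul, Finset.sum_sub_distrib, mul_smul,
        ← Finset.smul_sum, s.1.sum_repr]
      simp
  · rintro ⟨t, ht, hx⟩
    obtain ⟨i, hi, rfl⟩ := (mem_refine_of hs).1 ht
    obtain ⟨c, hc, rfl⟩ := (inCone_iff _ _).1 hx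
    refine inCone_sum _ _ _ _ (fun i _ => hc i) fun j _ => ?_
    rw [exch_apply _ _ _ hi]
    split_ifs
    · exact hs
    · exact inCone_basis _ _

open Classical in
lemma refine_good {d : ℕ} {u : Fin d → ℝ} {F : Finset (RCell d)} (hF : GoodFan F) {ε : ℝ}
    (hε : 0 < ε)
    (h1 : ∀ s ∈ F, ∀ t ∈ F, ∀ i j, t.2 (s.1 j) < s.2 (s.1 j) →
      t.2 (s.1 j) - ε / t.1.repr u i * t.1.repr (s.1 j) i < s.2 (s.1 j))
    (h2 : ∀ s ∈ F, ∀ t ∈ F, s.2 u < t.2 u → s.2 u < t.2 u - ε) :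
    GoodFan (F.biUnion (refineCell u ε)) := by
  intro s' hs' t' ht' k
  obtain ⟨s, hs, hs'⟩ := Finset.mem_biUnion.1 hs'
  obtain ⟨t, ht, ht'⟩ := Finset.mem_biUnion.1 ht'
  have key : (InCone s.1 u ∧ s'.1 k = u ∧ s'.2 u = s.2 u - ε) ∨
      (∃ j, s'.1 k = s.1 j ∧ s'.2 (s.1 j) = s.2 (s.1 j)) := by
    by_cases hsu : InCone s.1 u
    · obtain ⟨i, hi, rfl⟩ := (mem_refine_of hsu).1 hs'
      simp only [exch_apply _ _ _ hi]
      by_cases hk : k = i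
      · left
        refine ⟨hsu, by simp [hk], ?_⟩
        simp [hi]
      · right
        refine ⟨k, by simp [hk], ?_⟩
        simp [Finsupp.single_apply, hk]
    · right
      rw [mem_refine_of_not hsu] at hs'
      subst hs'
      exact ⟨k, rfl, rfl⟩
  rcases key with ⟨hsu, hk, hl⟩ | ⟨j, hk, hl⟩
  · rw [hk, hl]
    by_cases htu : InCone t.1 u
    · obtain ⟨i, hi, rfl⟩ := (mem_refine_of htu).1 ht'
      have heq : t.2 u = s.2 u := le_antisymm (good_le hF hs ht hsu) (good_le hF ht hs htu)
      refine ⟨by simp [hi, heq], fun _ => ⟨i, by simp [exch_apply _ _ _ hi]⟩⟩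
    · rw [mem_refine_of_not htu] at ht'
      subst ht'
      have hlt : t'.2 u < s.2 u := lt_of_le_of_ne (good_le hF hs ht hsu) fun h =>
        htu (good_inCone hF hs ht hsu h)
      have := h2 t' ht s hs hlt
      exact ⟨this.le, fun h => absurd h this.ne⟩
  · rw [hk, hl]
    by_cases htu : InCone t.1 u
    · obtain ⟨i, hi, rfl⟩ := (mem_refine_of htu).1 ht'
      have hv : (t.2 - (ε / t.1.repr u i) • t.1.coord i) (s.1 j) =
        t.2 (s.1 j) - ε / t.1.repr u i * t.1.repr (s.1 j) i := by simp
      simp only [hv]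
      rcases (hF s hs t ht j).1.lt_or_eq with hlt | heq
      · have := h1 s hs t ht i j hlt
        exact ⟨this.le, fun h => absurd h this.ne⟩
      · obtain ⟨m, hm⟩ := (hF s hs t ht j).2 heq
        have hpos : 0 < t.1.repr u i := lt_of_le_of_ne (htu i) (Ne.symm hi)
        have hpos' : 0 < ε / t.1.repr u i := div_pos hε hpos
        rw [heq, ← hm, t.1.repr_self, Finsupp.single_apply]
        by_cases hmi : m = i
        · simp only [hmi, if_true, mul_one]
          refine ⟨by linarith, fun h => ?_⟩
          linarith
        · simp only [hmi, if_false, mul_zero, sub_zero]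
          exact ⟨le_rfl, fun _ => ⟨m, by simp [exch_apply _ _ _ hi, hmi]⟩⟩
    · rw [mem_refine_of_not htu] at ht'
      subst ht'
      exact hF s hs t' ht j

lemma exists_eps {d : ℕ} (u : Fin d → ℝ) (F : Finset (RCell d)) : ∃ ε : ℝ, 0 < ε ∧
    (∀ s ∈ F, ∀ t ∈ F, ∀ i j, t.2 (s.1 j) < s.2 (s.1 j) →
      t.2 (s.1 j) - ε / t.1.repr u i * t.1.repr (s.1 j) i < s.2 (s.1 j)) ∧
    (∀ s ∈ F, ∀ t ∈ F, s.2 u < t.2 u → s.2 u < t.2 u - ε) := by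
  have h1 : ∀ᶠ ε : ℝ in nhds 0, (∀ s ∈ F, ∀ t ∈ F, ∀ i j, t.2 (s.1 j) < s.2 (s.1 j) →
      t.2 (s.1 j) - ε / t.1.repr u i * t.1.repr (s.1 j) i < s.2 (s.1 j)) := by
    rw [Filter.eventually_all_finset]; intro s _
    rw [Filter.eventually_all_finset]; intro t _
    rw [Filter.eventually_all]; intro i
    rw [Filter.eventually_all]; intro j
    rw [Filter.eventually_imp_distrib_left]; intro h
    have hc : Continuous fun ε : ℝ =>
        t.2 (s.1 j) - ε / t.1.repr u i * t.1.repr (s.1 j) i := by fun_prop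
    exact (hc.tendsto 0).eventually_lt_const (by simpa using h)
  have h2 : ∀ᶠ ε : ℝ in nhds 0, (∀ s ∈ F, ∀ t ∈ F, s.2 u < t.2 u → s.2 u < t.2 u - ε) := by
    rw [Filter.eventually_all_finset]; intro s _
    rw [Filter.eventually_all_finset]; intro t _
    rw [Filter.eventually_imp_distrib_left]; intro h
    have hc : Continuous fun ε : ℝ => t.2 u - ε := by fun_prop
    exact (hc.tendsto 0).eventually_const_lt (by simpa using h)
  have h3 : ∀ᶠ ε : ℝ in nhdsWithin 0 (Set.Ioi 0), 0 < ε := eventually_mem_nhdsWithin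
  have := h3.and ((h1.and h2).filter_mono nhdsWithin_le_nhds)
  exact this.exists

/-- multiplicity -/
noncomputable def bmult {d : ℕ} (b : Module.Basis (Fin d) ℝ (Fin d → ℝ)) : ℕ := ⌊|bdet b|⌋₊

lemma bmult_eq {d : ℕ} (b : Module.Basis (Fin d) ℝ (Fin d → ℝ)) (h : ∀ i, IsIntVec (b i)) :
    (bmult b : ℝ) = |bdet b| := by
  choose A hA using h
  obtain ⟨z, hz⟩ : ∃ z : ℤ, bdet b = (z : ℝ) := by
    refine ⟨(Matrix.of A).det, ?_⟩
    rw [bdet, Int.cast_det]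
    congr 1
    ext i j
    exact hA i j
  have h2 : |(z : ℝ)| = ((z.natAbs : ℕ) : ℝ) := by simp [Nat.cast_natAbs]
  rw [bmult, hz, h2, Nat.floor_natCast]

/-- potential -/
noncomputable def pot {d : ℕ} (F : Finset (RCell d)) : ℕ := ∑ s ∈ F, (d + 1) ^ bmult s.1

open Classical in
lemma sum_biUnion_le_aux {α : Type*} (F : Finset α) (r : α → Finset α) (g : α → ℕ) :
    ∑ s ∈ F.biUnion r, g s ≤ ∑ s ∈ F, ∑ t ∈ r s, g t := by
  induction F using Finset.induction_on with
  | empty => simp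
  | insert a F ha ih =>
    rw [Finset.biUnion_insert, Finset.sum_insert ha]
    have := Finset.sum_union_inter (s₁ := r a) (s₂ := F.biUnion r) (f := g)
    omega

open Classical in
lemma pot_refine_lt {d : ℕ} {u : Fin d → ℝ} (ε : ℝ) (s : RCell d) (hs : InCone s.1 u)
    (hIntegral : ∀ i, IsIntVec (s.1 i)) (hlt : ∀ i, s.1.repr u i < 1) :
    ∑ t ∈ refineCell u ε s, (d + 1) ^ bmult t.1 < (d + 1) ^ bmult s.1 := by
  have hm := bmult_eq s.1 hIntegral
  have hpos : 0 < |bdet s.1| := abs_pos.2 (bdet_ne_zero _)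
  have hm0 : 0 < bmult s.1 := by
    have : (0 : ℝ) < bmult s.1 := by rw [hm]; exact hpos
    exact_mod_cast this
  have hle : ∀ t ∈ refineCell u ε s, (d + 1) ^ bmult t.1 ≤ (d + 1) ^ (bmult s.1 - 1) := by
    intro t ht
    obtain ⟨i, hi, rfl⟩ := (mem_refine_of hs).1 ht
    apply Nat.pow_le_pow_right (Nat.succ_pos d)
    have : bmult (exch s.1 u i) < bmult s.1 := by
      rw [bmult, exch_det _ _ _ hi, Nat.floor_lt (abs_nonneg _), hm, abs_mul,
        abs_of_nonneg (hs i)]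
      exact mul_lt_of_lt_one_left hpos (hlt i)
    show bmult (exch s.1 u i) ≤ _
    omega
  have hcard : (refineCell u ε s).card ≤ d := by
    rw [refineCell, if_pos hs]
    refine Finset.card_image_le.trans ((Finset.card_filter_le _ _).trans ?_)
    simp
  calc _ ≤ (refineCell u ε s).card • (d + 1) ^ (bmult s.1 - 1) :=
        Finset.sum_le_card_nsmul _ _ _ hle
    _ ≤ d * (d + 1) ^ (bmult s.1 - 1) := by
        rw [smul_eq_mul]; exact Nat.mul_le_mul_right _ hcard
    _ < (d + 1) * (d + 1) ^ (bmult s.1 - 1) :=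
        Nat.mul_lt_mul_of_pos_right (Nat.lt_succ_self d) (by positivity)
    _ = (d + 1) ^ bmult s.1 := by
        rw [← pow_succ', Nat.sub_add_cancel hm0]

/-- One stellar step. -/
lemma stellar_step {d : ℕ} {F : Finset (RCell d)} (hF : GoodFan F)
    (hIntegral : ∀ s ∈ F, ∀ i, IsIntVec (s.1 i)) {u : Fin d → ℝ} (hu : u ≠ 0) (hui : IsIntVec u)
    {s : RCell d} (hs : s ∈ F) (hsu : InCone s.1 u) (hlt : ∀ i, s.1.repr u i < 1) :
    ∃ F' : Finset (RCell d), GoodFan F' ∧ (∀ s ∈ F', ∀ i, IsIntVec (s.1 i)) ∧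
      (∀ x, (∃ s ∈ F, InCone s.1 x) ↔ ∃ s ∈ F', InCone s.1 x) ∧ pot F' < pot F := by
  classical
  obtain ⟨ε, hε, h1, h2⟩ := exists_eps u F
  refine ⟨F.biUnion (refineCell u ε), ?_, ?_, ?_, ?_⟩
  · convert refine_good hF hε h1 h2
  · intro t' ht' i
    obtain ⟨t, ht, ht'⟩ := Finset.mem_biUnion.1 ht'
    by_cases htu : InCone t.1 u
    · obtain ⟨j, hj, rfl⟩ := (mem_refine_of htu).1 ht'
      rw [exch_apply _ _ _ hj]
      split_ifs
      · exact hui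
      · exact hIntegral t ht i
    · rw [mem_refine_of_not htu] at ht'
      subst ht'
      exact hIntegral _ ht i
  · intro x
    constructor
    · rintro ⟨t, ht, hx⟩
      obtain ⟨t', ht', hx'⟩ := (refine_cover hu ε t x).1 hx
      exact ⟨t', Finset.mem_biUnion.2 ⟨t, ht, ht'⟩, hx'⟩
    · rintro ⟨t', ht', hx'⟩
      obtain ⟨t, ht, ht'⟩ := Finset.mem_biUnion.1 ht'
      exact ⟨t, ht, (refine_cover hu ε t x).2 ⟨t', ht', hx'⟩⟩
  · unfold pot
    have hle : ∑ s ∈ F.biUnion (refineCell u ε), (d + 1) ^ bmult s.1 ≤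
        ∑ s ∈ F, ∑ t ∈ refineCell u ε s, (d + 1) ^ bmult t.1 := by
      convert sum_biUnion_le_aux F (refineCell u ε) (fun s => (d + 1) ^ bmult s.1)
    refine lt_of_le_of_lt hle (Finset.sum_lt_sum ?_ ⟨s, hs, ?_⟩)
    · intro t ht
      by_cases htu : InCone t.1 u
      · exact (pot_refine_lt ε t htu (hIntegral t ht) (good_coef_lt hF hs ht hsu htu hlt)).le
      · simp [refineCell, htu]
    · exact pot_refine_lt ε s hsu (hIntegral s hs) hlt

/-- Smoothness of a cell with respect to `ℤ^d`. -/
def SmoothCell {d : ℕ} (b : Module.Basis (Fin d) ℝ (Fin d → ℝ)) : Prop :=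
  ∀ x, IsIntVec x → InCone b x → ∃ c : Fin d → ℕ, x = ∑ i, (c i : ℝ) • b i

lemma IsIntVec.sub {d : ℕ} {x y : Fin d → ℝ} (hx : IsIntVec x) (hy : IsIntVec y) :
    IsIntVec (x - y) := by
  intro i
  obtain ⟨a, ha⟩ := hx i
  obtain ⟨b, hb⟩ := hy i
  exact ⟨a - b, by simp [ha, hb]⟩

lemma IsIntVec.nsum {d : ℕ} {ι : Type*} (s : Finset ι) (c : ι → ℕ) (x : ι → Fin d → ℝ)
    (hx : ∀ i, IsIntVec (x i)) : IsIntVec (∑ i ∈ s, (c i : ℝ) • x i) := by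
  intro j
  choose A hA using hx
  exact ⟨∑ i ∈ s, (c i : ℤ) * A i j, by simp [Finset.sum_apply, hA]⟩

lemma exists_smooth_refinement {d : ℕ} (N : ℕ) : ∀ F : Finset (RCell d), pot F = N → GoodFan F →
    (∀ s ∈ F, ∀ i, IsIntVec (s.1 i)) →
    ∃ F' : Finset (RCell d), GoodFan F' ∧ (∀ s ∈ F', ∀ i, IsIntVec (s.1 i)) ∧
      (∀ x, (∃ s ∈ F, InCone s.1 x) ↔ ∃ s ∈ F', InCone s.1 x) ∧
      ∀ s ∈ F', SmoothCell s.1 := by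
  induction N using Nat.strong_induction_on with
  | _ N ih =>
  intro F hN hF hIntegral
  by_cases hsm : ∀ s ∈ F, SmoothCell s.1
  · exact ⟨F, hF, hIntegral, fun _ => Iff.rfl, hsm⟩
  · push Not at hsm
    obtain ⟨s, hs, hns⟩ := hsm
    unfold SmoothCell at hns
    push Not at hns
    obtain ⟨x, hxi, hxc, hx⟩ := hns
    set c : Fin d → ℕ := fun i => ⌊s.1.repr x i⌋₊ with hc
    set u := x - ∑ i, (c i : ℝ) • s.1 i with hu
    have hrep : ∀ i, s.1.repr u i = s.1.repr x i - c i := by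
      intro i
      simp [hu, Finsupp.single_apply]
    obtain ⟨F1, hF1, hIntegral1, hcov1, hpot⟩ := stellar_step hF hIntegral (u := u)
      (fun h => hx c (sub_eq_zero.1 h)) (hxi.sub (IsIntVec.nsum _ _ _ (hIntegral s hs))) hs
      (fun i => by
        rw [hrep, sub_nonneg]; exact Nat.floor_le (hxc i))
      (fun i => by
        rw [hrep]; have := Nat.lt_floor_add_one (s.1.repr x i); simp only [hc]; linarith)
    obtain ⟨F2, a, b, c, e⟩ := ih _ (hN ▸ hpot) F1 rfl hF1 hIntegral1
    exact ⟨F2, a, b, fun x => (hcov1 x).trans (c x), e⟩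

/-- Genericity of heights. -/
def GenericHeights {d n : ℕ} (v : Fin n → (Fin d → ℝ)) (ω : Fin n → ℝ) : Prop :=
  ∀ (σ : Fin d → Fin n) (b : Module.Basis (Fin d) ℝ (Fin d → ℝ)), (∀ j, b j = v (σ j)) →
    ∀ i, i ∉ Set.range σ → ω i ≠ ∑ j, b.repr (v i) j * ω (σ j)

lemma exists_starting_basis {d n : ℕ} (v : Fin n → (Fin d → ℝ))
    (hv : Submodule.span ℝ (Set.range v) = ⊤) :
    ∃ (σ : Fin d → Fin n) (b : Module.Basis (Fin d) ℝ (Fin d → ℝ)), ∀ j, b j = v (σ j) := by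
  obtain ⟨κ, a, ha, hspan, hli⟩ := exists_linearIndependent' ℝ v
  let B : Module.Basis κ ℝ (Fin d → ℝ) := Module.Basis.mk hli (by rw [hspan, hv])
  let e : κ ≃ Fin d := B.indexEquiv (Pi.basisFun ℝ (Fin d))
  exact ⟨fun j => a (e.symm j), B.reindex e, fun j => by simp [B]⟩

lemma exists_generic {d n : ℕ} (v : Fin n → (Fin d → ℝ)) : ∃ ω, GenericHeights v ω := by
  classical
  let J := {p : (Fin d → Fin n) × Fin n // (∃ b : Module.Basis (Fin d) ℝ (Fin d → ℝ),
    ∀ j, b j = v (p.1 j)) ∧ p.2 ∉ Set.range p.1}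
  have hB : ∀ p : J, ∃ b : Module.Basis (Fin d) ℝ (Fin d → ℝ), ∀ j, b j = v (p.1.1 j) :=
    fun p => p.2.1
  choose B hB using hB
  let q : J → (Fin n → ℝ) := fun p => Pi.single p.1.2 1 -
    ∑ j, (B p).repr (v p.1.2) j • Pi.single (p.1.1 j) 1
  have hq : ∀ p, q p ≠ 0 := by
    intro p h
    have h1 := congrFun h p.1.2
    have h2 : ∀ j, p.1.2 ≠ p.1.1 j := fun j hj => p.2.2 ⟨j, hj.symm⟩
    simp [q, Finset.sum_apply, Pi.single_apply, h2] at h1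
  obtain ⟨f, hf⟩ := Module.exists_dual_forall_apply_ne_zero (K := ℝ) q hq
  refine ⟨fun i => f (Pi.single i 1), ?_⟩
  intro σ b hb i hi heq
  let p : J := ⟨(σ, i), ⟨b, hb⟩, hi⟩
  have hBb : B p = b := Module.Basis.eq_of_apply_eq fun j => by rw [hB p, hb]
  apply hf p
  simp only [q, map_sub, map_sum, map_smul, smul_eq_mul, hBb]
  rw [sub_eq_zero]
  exact heq

lemma exists_heights {d n : ℕ} (v : Fin n → (Fin d → ℝ)) (σ : Fin d → Fin n)
    (b : Module.Basis (Fin d) ℝ (Fin d → ℝ)) (hb : ∀ j, b j = v (σ j)) :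
    ∃ ω, GenericHeights v ω ∧ ∀ i, ∑ j, b.repr (v i) j * ω (σ j) ≤ ω i := by
  classical
  obtain ⟨ω1, h1⟩ := exists_generic v
  let ω0 : Fin n → ℝ := fun i => if i ∈ Set.range σ then 0 else 1
  let Ω : ℝ → Fin n → ℝ := fun ε i => ω0 i + ε * ω1 i
  have hgen : ∀ᶠ ε in nhdsWithin (0 : ℝ) (Set.Ioi 0), ∀ (p : Fin d → Fin n),
      ∀ i, ∀ b : Module.Basis (Fin d) ℝ (Fin d → ℝ), (∀ j, b j = v (p j)) →
      i ∉ Set.range p → Ω ε i ≠ ∑ j, b.repr (v i) j * Ω ε (p j) := by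
    rw [Filter.eventually_all]; intro p
    rw [Filter.eventually_all]; intro i
    by_cases hex : ∃ b : Module.Basis (Fin d) ℝ (Fin d → ℝ), ∀ j, b j = v (p j)
    swap
    · exact Filter.Eventually.of_forall fun ε b hb => absurd ⟨b, hb⟩ hex
    obtain ⟨b, hb⟩ := hex
    by_cases hi : i ∈ Set.range p
    · exact Filter.Eventually.of_forall fun ε b hb h => absurd hi h
    have hne := h1 p b hb i hi
    have key : ∀ᶠ ε in nhdsWithin (0 : ℝ) (Set.Ioi 0),
        Ω ε i ≠ ∑ j, b.repr (v i) j * Ω ε (p j) := by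
      have hform : ∀ ε, Ω ε i - ∑ j, b.repr (v i) j * Ω ε (p j) =
          (ω0 i - ∑ j, b.repr (v i) j * ω0 (p j)) +
          ε * (ω1 i - ∑ j, b.repr (v i) j * ω1 (p j)) := by
        intro ε
        simp only [Ω, mul_add, Finset.sum_add_distrib, mul_sub, Finset.mul_sum]
        have : ∀ j, b.repr (v i) j * (ε * ω1 (p j)) = ε * (b.repr (v i) j * ω1 (p j)) :=
          fun j => by ring
        simp only [this]
        ring
      generalize (ω0 i - ∑ j, b.repr (v i) j * ω0 (p j)) = A at hform
      have hB : ω1 i - ∑ j, b.repr (v i) j * ω1 (p j) ≠ 0 := sub_ne_zero.2 hne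
      generalize (ω1 i - ∑ j, b.repr (v i) j * ω1 (p j)) = B at hform hB
      have : ∀ᶠ ε in nhdsWithin (0 : ℝ) (Set.Ioi 0), A + ε * B ≠ 0 := by
        by_cases hA : A = 0
        · filter_upwards [eventually_mem_nhdsWithin] with ε hε
          have : ε ≠ 0 := ne_of_gt hε
          simp [hA, this, hB]
        · have hc : Continuous fun ε : ℝ => A + ε * B := by fun_prop
          exact ((hc.tendsto 0).eventually_ne (by simpa using hA)).filter_mono
            nhdsWithin_le_nhds
      filter_upwards [this] with ε hε h
      exact hε (by rw [← hform, h, sub_self])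
    filter_upwards [key] with ε hε b' hb' _
    have : b' = b := Module.Basis.eq_of_apply_eq fun j => by rw [hb', hb]
    rw [this]
    exact hε
  have hfeas : ∀ᶠ ε in nhdsWithin (0 : ℝ) (Set.Ioi 0), ∀ i,
      ∑ j, b.repr (v i) j * Ω ε (σ j) ≤ Ω ε i := by
    rw [Filter.eventually_all]; intro i
    by_cases hi : i ∈ Set.range σ
    · obtain ⟨m, rfl⟩ := hi
      refine Filter.Eventually.of_forall fun ε => ?_
      rw [← hb, b.repr_self]
      simp [Finsupp.single_apply]
    · have hc : Continuous fun ε : ℝ => Ω ε i - ∑ j, b.repr (v i) j * Ω ε (σ j) := by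
        fun_prop
      have h0 : 0 < Ω 0 i - ∑ j, b.repr (v i) j * Ω 0 (σ j) := by
        have hi' : ∀ j, σ j ≠ i := fun j hj => hi ⟨j, hj⟩
        simp [Ω, ω0, hi']
      have := ((hc.tendsto 0).eventually_const_lt h0).filter_mono
        (nhdsWithin_le_nhds (s := Set.Ioi 0))
      filter_upwards [this] with ε hε
      linarith
  obtain ⟨ε, he1, he2⟩ := (hgen.and hfeas).exists
  exact ⟨Ω ε, fun p b hb i hi => he1 p i b hb hi, he2⟩

/-- Existence of a regular triangulation of a full-dimensional cone. -/
lemma exists_triangulation {d n : ℕ} (v : Fin n → (Fin d → ℝ))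
    (hv : Submodule.span ℝ (Set.range v) = ⊤) :
    ∃ F : Finset (RCell d), GoodFan F ∧ (∀ s ∈ F, ∀ j, ∃ i, s.1 j = v i) ∧
      ∀ x, x ∈ polyCone v ↔ ∃ s ∈ F, InCone s.1 x := by
  classical
  obtain ⟨σ0, b0, hb0⟩ := exists_starting_basis v hv
  obtain ⟨ω, hgen, hfeas0⟩ := exists_heights v σ0 b0 hb0
  let S := {σ : Fin d → Fin n // ∃ s : RCell d, (∀ j, s.1 j = v (σ j)) ∧
    (∀ j, s.2 (s.1 j) = ω (σ j)) ∧ ∀ i, s.2 (v i) ≤ ω i}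
  have hS : ∀ σ : S, ∃ s : RCell d, (∀ j, s.1 j = v (σ.1 j)) ∧
    (∀ j, s.2 (s.1 j) = ω (σ.1 j)) ∧ ∀ i, s.2 (v i) ≤ ω i := fun σ => σ.2
  choose c hc1 hc2 hc3 using hS
  have hval : ∀ (σ : S) (i : Fin n), (c σ).2 (v i) = ∑ j, (c σ).1.repr (v i) j * ω (σ.1 j) := by
    intro σ i
    rw [fun_eq_sum (c σ).1 (c σ).2]
    simp only [hc2]
  have hstrict : ∀ (σ : S) (i : Fin n), i ∉ Set.range σ.1 → (c σ).2 (v i) < ω i := by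
    intro σ i hi
    refine lt_of_le_of_ne (hc3 σ i) fun h => ?_
    exact hgen σ.1 (c σ).1 (hc1 σ) i hi (h ▸ hval σ i)
  have hne : Nonempty S := by
    refine ⟨⟨σ0, (b0, b0.constr ℝ fun j => ω (σ0 j)), hb0, fun j => ?_, fun i => ?_⟩⟩
    · simp
    · rw [fun_eq_sum b0]
      simpa using hfeas0 i
  refine ⟨Finset.univ.image c, ?_, ?_, ?_⟩
  · intro s hs t ht i
    obtain ⟨σ, -, rfl⟩ := Finset.mem_image.1 hs
    obtain ⟨τ, -, rfl⟩ := Finset.mem_image.1 ht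
    rw [hc2, hc1]
    refine ⟨hc3 τ _, fun h => ?_⟩
    by_contra hcon
    have : σ.1 i ∉ Set.range τ.1 := by
      rintro ⟨j, hj⟩
      exact hcon ⟨j, by rw [hc1, hj]⟩
    exact (hstrict τ _ this).ne h
  · intro s hs j
    obtain ⟨σ, -, rfl⟩ := Finset.mem_image.1 hs
    exact ⟨_, hc1 σ j⟩
  · intro x
    constructor
    · rintro ⟨a, ha, hx⟩
      obtain ⟨σ, hmax⟩ := Finite.exists_max (fun σ : S => (c σ).2 x)
      refine ⟨c σ, Finset.mem_image_of_mem _ (Finset.mem_univ _), ?_⟩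
      intro j
      by_contra hj
      rw [not_le] at hj
      by_cases hT : ∃ i, (c σ).1.repr (v i) j < 0
      swap
      · push Not at hT
        have : (c σ).1.repr x j = ∑ i, a i * (c σ).1.repr (v i) j := by
          rw [hx]
          simp only [map_sum, map_smul, Finsupp.coe_finsetSum, Finset.sum_apply,
            Finsupp.coe_smul, Pi.smul_apply, smul_eq_mul]
        rw [this] at hj
        exact absurd hj (not_lt.2 (Finset.sum_nonneg fun i _ => mul_nonneg (ha i) (hT i)))
      obtain ⟨i, hi, hmin⟩ := Finset.exists_min_image
        (Finset.univ.filter fun i => (c σ).1.repr (v i) j < 0)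
        (fun i => (ω i - (c σ).2 (v i)) / (-(c σ).1.repr (v i) j))
        (by obtain ⟨i, hi⟩ := hT; exact ⟨i, by simpa using hi⟩)
      replace hi : (c σ).1.repr (v i) j < 0 := by simpa using hi
      set t := (ω i - (c σ).2 (v i)) / (-(c σ).1.repr (v i) j) with ht
      have hir : i ∉ Set.range σ.1 := by
        rintro ⟨m, rfl⟩
        rw [← hc1] at hi
        exact absurd hi (not_lt.2 (inCone_basis _ _ _))
      have ht0 : 0 < t := div_pos (sub_pos.2 (hstrict σ i hir)) (neg_pos.2 hi)
      let l' : (Fin d → ℝ) →ₗ[ℝ] ℝ := (c σ).2 - t • (c σ).1.coord j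
      have hl' : ∀ y, l' y = (c σ).2 y - t * (c σ).1.repr y j := fun y => by simp [l']
      let b' := exch (c σ).1 (v i) j
      have hb' : ∀ k, b' k = if k = j then v i else (c σ).1 k := exch_apply _ _ _ hi.ne
      have hli : l' (v i) = ω i := by
        rw [hl', ht]
        have : (c σ).1.repr (v i) j ≠ 0 := hi.ne
        field_simp
        ring
      have hσ'1 : ∀ k, b' k = v (Function.update σ.1 j i k) := by
        intro k
        rw [hb', Function.update_apply]
        split_ifs
        · rfl
        · exact hc1 σ k
      have hσ'2 : ∀ k, l' (b' k) = ω (Function.update σ.1 j i k) := by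
        intro k
        rw [hb', Function.update_apply]
        split_ifs with hk
        · exact hli
        · rw [hl', (c σ).1.repr_self, hc2]
          simp [Finsupp.single_apply, hk]
      have hσ'3 : ∀ m, l' (v m) ≤ ω m := by
        intro m
        rw [hl']
        by_cases hm : (c σ).1.repr (v m) j < 0
        · have h1 := hmin m (by simpa using hm)
          have h2 := (le_div_iff₀ (neg_pos.2 hm)).1 h1
          linarith
        · have h1 := hc3 σ m
          have h2 := mul_nonneg ht0.le (not_lt.1 hm)
          linarith
      let σ' : S := ⟨Function.update σ.1 j i, (b', l'), hσ'1, hσ'2, hσ'3⟩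
      have hEq : (c σ').2 = l' := by
        refine b'.ext fun k => ?_
        rw [hσ'2, hσ'1]
        have := hc2 σ' k
        rw [hc1] at this
        exact this
      have h3 := hmax σ'
      simp only [hEq, hl'] at h3
      have h4 : t * (c σ).1.repr x j < 0 := mul_neg_of_pos_of_neg ht0 hj
      linarith
    · rintro ⟨s, hs, hx⟩
      obtain ⟨σ, -, rfl⟩ := Finset.mem_image.1 hs
      obtain ⟨a, ha, rfl⟩ := (inCone_iff _ _).1 hx
      refine ⟨fun i => ∑ j, if σ.1 j = i then a j else 0, fun i => ?_, ?_⟩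
      · exact Finset.sum_nonneg fun j _ => by split_ifs; exacts [ha j, le_rfl]
      · simp only [Finset.sum_smul, hc1]
        rw [Finset.sum_comm]
        refine Finset.sum_congr rfl fun j _ => ?_
        simp [ite_smul]

lemma real_li_of_int_li {k d : ℕ} (B : Fin d → (Fin k → ℝ)) (B' : Fin d → (Fin k → ℚ))
    (hBB : ∀ i j, B i j = (B' i j : ℝ)) (h : LinearIndependent ℤ B) :
    LinearIndependent ℚ B' ∧ LinearIndependent ℝ B := by
  have hB : B = fun i => algebraMap ℚ ℝ ∘ B' i := by
    funext i j
    simp [hBB]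
  have h1 : LinearIndependent ℤ B' := by
    let f : (Fin k → ℚ) →ₗ[ℤ] (Fin k → ℝ) := ((algebraMap ℚ ℝ).toAddMonoidHom.compLeft
      (Fin k)).toIntLinearMap
    have : B = f ∘ B' := by
      rw [hB]
      rfl
    rw [this] at h
    exact h.of_comp
  have h2 : LinearIndependent ℚ B' := (LinearIndependent.iff_fractionRing ℤ ℚ).1 h1
  refine ⟨h2, ?_⟩
  rw [hB]
  exact linearIndependent_algebraMap_comp_iff.2 h2

lemma rat_coords {k d : ℕ} (B : Fin d → (Fin k → ℝ)) (B' : Fin d → (Fin k → ℚ))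
    (hBB : ∀ i j, B i j = (B' i j : ℝ)) (h : LinearIndependent ℚ B')
    (v : Fin k → ℝ) (hv : IsRat v) (hs : v ∈ Submodule.span ℝ (Set.range B)) :
    ∃ q : Fin d → ℚ, v = ∑ i, (q i : ℝ) • B i := by
  choose v' hv' using hv
  have hmem : v' ∈ Submodule.span ℚ (Set.range B') := by
    by_contra hcon
    have h1 : LinearIndependent ℚ (Fin.cons v' B' : Fin (d + 1) → (Fin k → ℚ)) :=
      linearIndependent_finCons.2 ⟨h, hcon⟩
    have h2 := (linearIndependent_algebraMap_comp_iff (S := ℝ)).2 h1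
    have h3 : (fun i => algebraMap ℚ ℝ ∘ (Fin.cons v' B' : Fin (d + 1) → (Fin k → ℚ)) i) =
        Fin.cons v B := by
      funext i
      refine Fin.cases ?_ (fun i => ?_) i
      · funext j; simp [hv']
      · funext j; simp [hBB]
    rw [h3, linearIndependent_finCons] at h2
    exact h2.2 hs
  obtain ⟨q, hq⟩ := (Submodule.mem_span_range_iff_exists_fun ℚ).1 hmem
  refine ⟨q, ?_⟩
  funext j
  rw [hv' j, ← hq]
  simp [Finset.sum_apply, hBB]

lemma exists_clear {d : ℕ} (q : Fin d → ℚ) : ∃ N : ℕ, 0 < N ∧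
    IsIntVec (fun i => (N : ℝ) * (q i : ℝ)) := by
  refine ⟨∏ i, (q i).den, Finset.prod_pos fun i _ => (q i).pos, fun i => ?_⟩
  refine ⟨(∏ j ∈ Finset.univ.erase i, (q j).den : ℕ) * (q i).num, ?_⟩
  rw [← Finset.mul_prod_erase Finset.univ _ (Finset.mem_univ i)]
  have : ((q i).den : ℝ) * (q i : ℝ) = (q i).num := by
    have := Rat.den_mul_eq_num (q i)
    exact_mod_cast this
  push_cast
  rw [mul_right_comm, this, mul_comm]

lemma exists_lattice_basis {k : ℕ} (Λ : AddSubgroup (Fin k → ℝ)) (hfg : Λ.FG) :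
    ∃ (d : ℕ) (B : Fin d → (Fin k → ℝ)), LinearIndependent ℤ B ∧
      ∀ x, x ∈ Λ ↔ ∃ z : Fin d → ℤ, x = ∑ i, (z i : ℝ) • B i := by
  let L := AddSubgroup.toIntSubmodule Λ
  have hL : L.FG := by
    rw [Submodule.fg_iff_addSubgroup_fg]
    simpa [L] using hfg
  have : Module.Finite ℤ L := Module.Finite.iff_fg.2 hL
  let b := Module.finBasis ℤ L
  refine ⟨_, fun i => (b i : Fin k → ℝ), ?_, ?_⟩
  · exact b.linearIndependent.map' L.subtype (Submodule.ker_subtype _)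
  · intro x
    have hsm : ∀ (z : ℤ) (y : Fin k → ℝ), (z : ℝ) • y = z • y := fun z y =>
      Int.cast_smul_eq_zsmul ℝ z y
    simp only [hsm]
    constructor
    · intro hx
      let x' : L := ⟨x, hx⟩
      refine ⟨fun i => b.repr x' i, ?_⟩
      have := congrArg (L.subtype) (b.sum_repr x')
      rw [map_sum] at this
      exact this.symm
    · rintro ⟨z, rfl⟩
      exact Λ.sum_mem fun i _ => Λ.zsmul_mem (b i).2 _

/-- every rational lattice cone can be subdivided into smooth lattice cones. -/
theorem latticeCone_smooth_subdivision {k : ℕ}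
    (C : Set (Fin k → ℝ)) (Λ : AddSubgroup (Fin k → ℝ)) (h : IsLatticeCone C Λ) :
    ∃ (r : ℕ) (D : Fin r → Set (Fin k → ℝ)),
      (C = ⋃ i, D i) ∧
      (∀ i, IsLatticeCone (D i) Λ) ∧
      (∀ i, Module.finrank ℝ (Submodule.span ℝ (D i)) =
        Module.finrank ℝ (Submodule.span ℝ C)) ∧
      (∀ i j, IsFace (D i) (D i ∩ D j) ∧ IsFace (D j) (D i ∩ D j)) ∧
      (∀ i, IsSmoothLatticeCone (D i) Λ) := by
  obtain ⟨⟨n, v, hvrat, rfl⟩, hΛrat, hfg, hspan⟩ := h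
  obtain ⟨d, B, hBli, hBΛ⟩ := exists_lattice_basis Λ hfg
  have hBmem : ∀ i, B i ∈ Λ := fun i => (hBΛ _).2 ⟨Pi.single i 1, by
    simp [Pi.single_apply]⟩
  choose B' hBB using fun i => hΛrat _ (hBmem i)
  obtain ⟨hQ, hR⟩ := real_li_of_int_li B B' hBB hBli
  -- the linear parametrisation
  let φ : (Fin d → ℝ) →ₗ[ℝ] (Fin k → ℝ) := Fintype.linearCombination ℝ B
  have hφ : ∀ y, φ y = ∑ i, y i • B i := fun y => Fintype.linearCombination_apply ℝ B y
  have hinj : Function.Injective φ := by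
    have := hR.fintypeLinearCombination_injective
    exact this
  obtain ⟨ψ, hψ⟩ := φ.exists_leftInverse_of_injective (LinearMap.ker_eq_bot.2 hinj)
  have hψφ : ∀ y, ψ (φ y) = y := fun y => LinearMap.congr_fun hψ y
  have hΛφ : ∀ x, x ∈ Λ ↔ ∃ y, IsIntVec y ∧ x = φ y := by
    intro x
    rw [hBΛ]
    constructor
    · rintro ⟨z, rfl⟩
      exact ⟨fun i => (z i : ℝ), fun i => ⟨z i, rfl⟩, (hφ _).symm⟩
    · rintro ⟨y, hy, rfl⟩
      choose z hz using hy
      exact ⟨z, by rw [hφ]; simp only [hz]⟩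
  have hspanB : Submodule.span ℝ (Λ : Set (Fin k → ℝ)) = Submodule.span ℝ (Set.range B) := by
    apply le_antisymm
    · rw [Submodule.span_le]
      intro x hx
      obtain ⟨z, rfl⟩ := (hBΛ x).1 hx
      exact Submodule.sum_mem _ fun i _ =>
        Submodule.smul_mem _ _ (Submodule.subset_span ⟨i, rfl⟩)
    · rw [Submodule.span_le]
      rintro _ ⟨i, rfl⟩
      exact Submodule.subset_span (hBmem i)
  have hrange : LinearMap.range φ = Submodule.span ℝ (Set.range B) :=
    Fintype.range_linearCombination ℝ B
  have hvC : ∀ i, v i ∈ polyCone v := fun i => ⟨Pi.single i 1, fun j => by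
    by_cases h : j = i
    · subst h; simp
    · simp [h], by simp [Pi.single_apply]⟩
  have hvmem : ∀ i, v i ∈ Submodule.span ℝ (Set.range B) := fun i => by
    rw [← hspanB, hspan]
    exact Submodule.subset_span (hvC i)
  choose q hq using fun i => rat_coords B B' hBB hQ (v i) (hvrat i) (hvmem i)
  choose N hN0 hNint using fun i => exists_clear (q i)
  let v' : Fin n → (Fin d → ℝ) := fun i j => (N i : ℝ) * (q i j : ℝ)
  have hv' : ∀ i, φ (v' i) = (N i : ℝ) • v i := by
    intro i
    rw [hφ, hq i, Finset.smul_sum]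
    simp only [v', mul_smul]
  have hNpos : ∀ i, (0 : ℝ) < N i := fun i => by exact_mod_cast hN0 i
  have hC : ∀ x, x ∈ polyCone v ↔ ∃ y ∈ polyCone v', x = φ y := by
    intro x
    constructor
    · rintro ⟨c, hc, rfl⟩
      refine ⟨_, ⟨fun i => c i / N i, fun i => div_nonneg (hc i) (hNpos i).le, rfl⟩, ?_⟩
      rw [map_sum]
      refine Finset.sum_congr rfl fun i _ => ?_
      rw [map_smul, hv', smul_smul, div_mul_cancel₀ _ (hNpos i).ne']
    · rintro ⟨_, ⟨c, hc, rfl⟩, rfl⟩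
      refine ⟨fun i => c i * N i, fun i => mul_nonneg (hc i) (hNpos i).le, ?_⟩
      rw [map_sum]
      refine Finset.sum_congr rfl fun i _ => ?_
      rw [map_smul, hv', smul_smul]
  have hspan' : Submodule.span ℝ (Set.range v') = ⊤ := by
    rw [eq_top_iff]
    intro y _
    have h1 : φ y ∈ Submodule.span ℝ (polyCone v) := by
      rw [← hspan, hspanB, ← hrange]
      exact ⟨y, rfl⟩
    have h2 : Submodule.span ℝ (polyCone v) ≤
        (Submodule.span ℝ (Set.range v')).map φ := by
      rw [Submodule.span_le]
      intro x hx
      obtain ⟨_, ⟨c, hc, rfl⟩, rfl⟩ := (hC x).1 hx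
      exact ⟨_, Submodule.sum_mem _ fun i _ =>
        Submodule.smul_mem _ _ (Submodule.subset_span ⟨i, rfl⟩), rfl⟩
    obtain ⟨y', hy', he⟩ := h2 h1
    rw [← hinj he]
    exact hy'
  obtain ⟨F0, hF0, hgen0, hcov0⟩ := exists_triangulation v' hspan'
  obtain ⟨F, hF, hIntegral, hcov, hsm⟩ := exists_smooth_refinement _ F0 rfl hF0 (by
    intro s hs j
    obtain ⟨i, hi⟩ := hgen0 s hs j
    rw [hi]
    exact hNint i)
  let e := F.equivFin
  let c : Fin F.card → RCell d := fun i => (e.symm i).1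
  have hc : ∀ i, c i ∈ F := fun i => (e.symm i).2
  let D : Fin F.card → Set (Fin k → ℝ) := fun i => polyCone (fun j => φ ((c i).1 j))
  have hD : ∀ i x, x ∈ D i ↔ ∃ y, InCone (c i).1 y ∧ x = φ y := by
    intro i x
    constructor
    · rintro ⟨a, ha, rfl⟩
      refine ⟨∑ j, a j • (c i).1 j, (inCone_iff _ _).2 ⟨a, ha, rfl⟩, ?_⟩
      simp only [map_sum, map_smul]
    · rintro ⟨y, hy, rfl⟩
      obtain ⟨a, ha, rfl⟩ := (inCone_iff _ _).1 hy
      refine ⟨a, ha, ?_⟩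
      simp only [map_sum, map_smul]
  have hDspan : ∀ i, Submodule.span ℝ (D i) = Submodule.span ℝ (Λ : Set (Fin k → ℝ)) := by
    intro i
    rw [hspanB, ← hrange]
    apply le_antisymm
    · rw [Submodule.span_le]
      intro x hx
      obtain ⟨y, _, rfl⟩ := (hD i x).1 hx
      exact ⟨y, rfl⟩
    · rintro _ ⟨y, rfl⟩
      rw [← (c i).1.sum_repr y, map_sum]
      refine Submodule.sum_mem _ fun j _ => ?_
      rw [map_smul]
      exact Submodule.smul_mem _ _ (Submodule.subset_span
        ((hD i _).2 ⟨_, inCone_basis _ j, rfl⟩))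
  have hface : ∀ i j, IsFace (D i) (D i ∩ D j) := by
    intro i j
    refine ⟨((c j).2 - (c i).2) ∘ₗ ψ, ?_, ?_⟩
    · intro x hx
      obtain ⟨y, hy, rfl⟩ := (hD i x).1 hx
      have := good_le hF (hc i) (hc j) hy
      simpa [hψφ] using this
    · ext x
      constructor
      · rintro ⟨hxi, hxj⟩
        refine ⟨hxi, ?_⟩
        obtain ⟨y, hy, rfl⟩ := (hD i x).1 hxi
        obtain ⟨y', hy', he⟩ := (hD j _).1 hxj
        have := hinj he
        subst this
        have h1 := good_le hF (hc i) (hc j) hy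
        have h2 := good_le hF (hc j) (hc i) hy'
        simp only [LinearMap.comp_apply, hψφ, LinearMap.sub_apply]
        linarith
      · rintro ⟨hxi, hx0⟩
        refine ⟨hxi, ?_⟩
        obtain ⟨y, hy, rfl⟩ := (hD i x).1 hxi
        simp only [LinearMap.comp_apply, hψφ, LinearMap.sub_apply] at hx0
        exact (hD j _).2 ⟨y, good_inCone hF (hc i) (hc j) hy (sub_eq_zero.1 hx0), rfl⟩
  have hgenΛ : ∀ i j, φ ((c i).1 j) ∈ Λ := fun i j =>
    (hΛφ _).2 ⟨_, hIntegral _ (hc i) j, rfl⟩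
  refine ⟨F.card, D, ?_, ?_, ?_, ?_, ?_⟩
  · ext x
    rw [hC, Set.mem_iUnion]
    constructor
    · rintro ⟨y, hy, rfl⟩
      obtain ⟨s, hs, hys⟩ := (hcov y).1 ((hcov0 y).1 hy)
      refine ⟨e ⟨s, hs⟩, (hD _ _).2 ⟨y, ?_, rfl⟩⟩
      simpa [c] using hys
    · rintro ⟨i, hx⟩
      obtain ⟨y, hy, rfl⟩ := (hD i x).1 hx
      exact ⟨y, (hcov0 y).2 ((hcov y).2 ⟨c i, hc i, hy⟩), rfl⟩
  · intro i
    exact ⟨⟨d, _, fun j => hΛrat _ (hgenΛ i j), rfl⟩, hΛrat, hfg, (hDspan i).symm⟩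
  · intro i
    rw [hDspan, hspan]
  · intro i j
    refine ⟨hface i j, ?_⟩
    rw [Set.inter_comm]
    exact hface j i
  · intro i
    refine ⟨d, fun j => φ ((c i).1 j), ?_, hgenΛ i, ?_⟩
    · exact (c i).1.linearIndependent.map' φ (LinearMap.ker_eq_bot.2 hinj)
    · ext x
      constructor
      · rintro ⟨hxΛ, hxD⟩
        obtain ⟨y, hy, rfl⟩ := (hD i x).1 hxD
        obtain ⟨y', hy', he⟩ := (hΛφ _).1 hxΛ
        have := hinj he
        subst this
        obtain ⟨a, ha⟩ := hsm _ (hc i) y hy' hy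
        refine ⟨a, ?_⟩
        conv_lhs => rw [ha]
        simp only [map_sum, map_smul]
      · rintro ⟨a, rfl⟩
        refine ⟨?_, ⟨fun j => (a j : ℝ), fun j => Nat.cast_nonneg _, rfl⟩⟩
        refine Λ.sum_mem fun j _ => ?_
        rw [Nat.cast_smul_eq_nsmul]
        exact Λ.nsmul_mem (hgenΛ i j) _
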